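/- arXiv:0712.0554 — 4 statements merged into one kernel-verified Lean document; each statement's English description precedes it below -/
import Mathlib

section
/- For every integer d ≥ 1 and every real ε with 0 < ε < 1, there exists a constant C (depending only on d and ε) such that the following holds: for every integer k ≥ 2, every finite set S of n points in ℝ^d, and every partition of S into k subsets C_1, …, C_k, there exists a subgraph G = (S, E) of the complete k-partite geometric graph K_{C_1…C_k} with at most C·n edges such that G is a (5+ε)-spanner of K_{C_1…C_k}, i.e., δ_E(p,q) ≤ (5+ε)·δ_K(p,q) for all p, q ∈ S. -/
open scoped ENNReal

/-- The length of a walk, given as the list of its vertices: the sum of the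
Euclidean distances between consecutive vertices. -/
noncomputable def walkLen {P : Type*} [PseudoEMetricSpace P] (xs : List P) : ℝ≥0∞ :=
  (List.zipWith edist xs xs.tail).sum

/-- `xs` is a walk from `p` to `q` in the graph with edge set `E`:
a nonempty finite sequence starting at `p`, ending at `q`, each consecutive
unordered pair being an edge of `E`. -/
def IsWalk {P : Type*} (E : Set (Sym2 P)) (p q : P) (xs : List P) : Prop :=
  xs.head? = some p ∧ xs.getLast? = some q ∧ xs.Chain' (fun a b => s(a, b) ∈ E)

/-- Graph distance: the infimum of lengths of walks from `p` to `q`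
(`∞` if no walk exists). -/
noncomputable def gdist {P : Type*} [PseudoEMetricSpace P] (E : Set (Sym2 P)) (p q : P) :
    ℝ≥0∞ :=
  ⨅ (xs : List P) (_ : IsWalk E p q xs), walkLen xs

/-- The edge set of the complete `k`-partite geometric graph whose color
classes are `C 0, …, C (k-1)`: all unordered pairs of points lying in two
different classes. -/
def kpartiteEdges {P : Type*} {k : ℕ} (C : Fin k → Set P) : Set (Sym2 P) :=
  {e | ∃ p q : P, e = s(p, q) ∧ ∃ i j : Fin k, i ≠ j ∧ p ∈ C i ∧ q ∈ C j}

section GraphDistance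

variable {P : Type*} [PseudoEMetricSpace P] {E : Set (Sym2 P)}

theorem walkLen_cons_cons (x y : P) (l : List P) :
    walkLen (x :: y :: l) = edist x y + walkLen (y :: l) := by
  simp [walkLen]

theorem gdist_self (p : P) : gdist E p p = 0 := by
  refine le_antisymm (iInf₂_le_of_le [p] ⟨rfl, rfl, List.isChain_singleton p⟩ ?_) bot_le
  simp [walkLen]

theorem gdist_le_edist_add {p y : P} (r : P) (h : s(p, y) ∈ E) :
    gdist E p r ≤ edist p y + gdist E y r := by
  simp only [gdist, ENNReal.add_iInf]
  refine le_iInf₂ fun ys hys => ?_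
  obtain ⟨h1, h2, h3⟩ := hys
  cases ys with
  | nil => simp at h1
  | cons z l =>
    obtain rfl : z = y := by simpa using h1
    refine iInf₂_le_of_le (p :: z :: l) ⟨rfl, by simpa using h2, ?_⟩
      (walkLen_cons_cons p z l).le
    exact List.isChain_cons_cons.2 ⟨h, h3⟩

theorem gdist_le_edist {p q : P} (h : s(p, q) ∈ E) : gdist E p q ≤ edist p q := by
  simpa [gdist_self] using gdist_le_edist_add q h

theorem gdist_triangle (p q r : P) : gdist E p r ≤ gdist E p q + gdist E q r := by
  have key : ∀ (xs : List P) (p : P), IsWalk E p q xs →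
      gdist E p r ≤ walkLen xs + gdist E q r := by
    intro xs
    induction xs with
    | nil => rintro p ⟨h, -⟩; simp at h
    | cons x l ih =>
      rintro p ⟨h1, h2, h3⟩
      obtain rfl : x = p := by simpa using h1
      cases l with
      | nil =>
        obtain rfl : x = q := by simpa using h2
        exact le_add_self
      | cons y l =>
        obtain ⟨hxy, h3⟩ := List.isChain_cons_cons.1 h3
        rw [walkLen_cons_cons, add_assoc]
        refine (gdist_le_edist_add r hxy).trans ?_
        gcongr
        exact ih y ⟨rfl, by simpa using h2, h3⟩
  conv_rhs => rw [gdist]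
  simp only [ENNReal.iInf_add]
  exact le_iInf₂ fun xs hxs => key xs p hxs

/-- A function satisfying the triangle inequality that is at most `c` times the length of every
edge is at most `c` times the graph distance. -/
theorem le_mul_gdist {φ : P → P → ℝ≥0∞} {c : ℝ≥0∞} (hc0 : c ≠ 0) (hc : c ≠ ⊤)
    (hself : ∀ x, φ x x = 0) (htri : ∀ x y z, φ x z ≤ φ x y + φ y z)
    (hedge : ∀ x y, s(x, y) ∈ E → φ x y ≤ c * edist x y) (p q : P) :
    φ p q ≤ c * gdist E p q := by
  have key : ∀ (xs : List P) (p : P), IsWalk E p q xs → φ p q ≤ c * walkLen xs := by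
    intro xs
    induction xs with
    | nil => rintro p ⟨h, -⟩; simp at h
    | cons x l ih =>
      rintro p ⟨h1, h2, h3⟩
      obtain rfl : x = p := by simpa using h1
      cases l with
      | nil =>
        obtain rfl : x = q := by simpa using h2
        simp [hself]
      | cons y l =>
        obtain ⟨hxy, h3⟩ := List.isChain_cons_cons.1 h3
        rw [walkLen_cons_cons, mul_add]
        exact (htri x y q).trans
          (add_le_add (hedge x y hxy) (ih y ⟨rfl, by simpa using h2, h3⟩))
  simp only [gdist, ENNReal.mul_iInf_of_ne hc0 hc]
  exact le_iInf₂ fun xs hxs => key xs p hxs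

theorem gdist_comm_le (p q : P) : gdist E q p ≤ gdist E p q := by
  simpa using le_mul_gdist (φ := fun x y => gdist E y x) (c := 1) (E := E) one_ne_zero
    ENNReal.one_ne_top gdist_self (fun x y z => by rw [add_comm]; exact gdist_triangle z y x)
    (fun x y h => by
      rw [one_mul, edist_comm]
      exact gdist_le_edist (by rwa [Sym2.eq_swap])) p q

end GraphDistance

section Reach

variable {P : Type*} [PseudoMetricSpace P] {E : Set (Sym2 P)} {p q r : P} {a b : ℝ}

/-- The real number `a` is nonnegative and bounds the graph distance from `p` to `q`. -/
def Reach (E : Set (Sym2 P)) (p q : P) (a : ℝ) : Prop :=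
  0 ≤ a ∧ gdist E p q ≤ ENNReal.ofReal a

theorem Reach.mono (h : Reach E p q a) (hab : a ≤ b) : Reach E p q b :=
  ⟨h.1.trans hab, h.2.trans (ENNReal.ofReal_le_ofReal hab)⟩

theorem Reach.symm (h : Reach E p q a) : Reach E q p a :=
  ⟨h.1, (gdist_comm_le p q).trans h.2⟩

theorem Reach.trans (h : Reach E p q a) (h' : Reach E q r b) : Reach E p r (a + b) :=
  ⟨add_nonneg h.1 h'.1, by
    rw [ENNReal.ofReal_add h.1 h'.1]
    exact (gdist_triangle p q r).trans (add_le_add h.2 h'.2)⟩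

theorem reach_of_mem (h : s(p, q) ∈ E) : Reach E p q (dist p q) :=
  ⟨dist_nonneg, by rw [← edist_dist]; exact gdist_le_edist h⟩

end Reach

section Choice

variable {α ι : Type*}

theorem exists_argmin_choice (A : ι → Finset α) [Nonempty α] (w : ι → α → ℝ) :
    ∃ F : ι → α, ∀ i, ∀ y ∈ A i, F i ∈ A i ∧ w i (F i) ≤ w i y := by
  have (i : ι) : ∃ x, ∀ y ∈ A i, x ∈ A i ∧ w i x ≤ w i y := by
    rcases (A i).eq_empty_or_nonempty with h | h
    · simp [h]
    · obtain ⟨x, hx, hmin⟩ := (A i).exists_min_image (w i) h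
      exact ⟨x, fun y hy => ⟨hx, hmin y hy⟩⟩
  choose F hF using this
  exact ⟨F, hF⟩

theorem Finset.strong_induction_real (T : Finset α) (w : α → ℝ) {Q : α → Prop}
    (h : ∀ x ∈ T, (∀ y ∈ T, w y < w x → Q y) → Q x) : ∀ x ∈ T, Q x := by
  classical
  by_contra! hbad
  obtain ⟨x, hx, hmin⟩ := (T.filter fun x => ¬ Q x).exists_min_image w
    (hbad.imp fun x hx => Finset.mem_filter.2 hx)
  rw [Finset.mem_filter] at hx
  refine hx.2 (h x hx.1 fun y hy hlt => ?_)
  by_contra hQ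
  exact (hmin y (Finset.mem_filter.2 ⟨hy, hQ⟩)).not_gt hlt

end Choice

section Grid

variable {d : ℕ}

/-- The index of the cell containing `x` in the axis-parallel grid of side length `h`. -/
noncomputable def gridCell (h : ℝ) (x : EuclideanSpace ℝ (Fin d)) : Fin d → ℤ :=
  fun j => ⌊x j / h⌋

theorem dist_le_of_gridCell_eq {h : ℝ} (hh : 0 < h) {x y : EuclideanSpace ℝ (Fin d)}
    (hxy : gridCell h x = gridCell h y) : dist x y ≤ d * h := by
  rw [EuclideanSpace.dist_eq, Real.sqrt_le_left (by positivity)]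
  have hcoord (j : Fin d) : dist (x j) (y j) ^ 2 ≤ h ^ 2 := by
    have := Int.abs_sub_lt_one_of_floor_eq_floor (congrFun hxy j)
    rw [← sub_div, abs_div, abs_of_pos hh, div_lt_one hh] at this
    rw [Real.dist_eq]
    gcongr
  calc ∑ j, dist (x j) (y j) ^ 2 ≤ ∑ _j : Fin d, h ^ 2 := Finset.sum_le_sum fun j _ => hcoord j
    _ = d * h ^ 2 := by simp
    _ ≤ (d * h) ^ 2 := by
      rw [mul_pow]
      gcongr
      exact_mod_cast Nat.le_self_pow two_ne_zero d

/-- The integer vectors all of whose coordinates are at most `R` in absolute value. -/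
noncomputable def intBox (d R : ℕ) : Finset (Fin d → ℤ) :=
  Fintype.piFinset fun _ => Finset.Icc (-(R : ℤ)) R

theorem gridCell_sub_mem_intBox {h : ℝ} (hh : 0 < h) {R : ℕ} {x y : EuclideanSpace ℝ (Fin d)}
    (hxy : dist x y ≤ R * h) : gridCell h y - gridCell h x ∈ intBox d (R + 1) := by
  rw [intBox, Fintype.mem_piFinset]
  intro j
  have hj : |y j / h - x j / h| ≤ R := by
    rw [← sub_div, abs_div, abs_of_pos hh, div_le_iff₀ hh, abs_sub_comm, ← Real.norm_eq_abs]
    exact (PiLp.norm_apply_le (x - y) j).trans (by rwa [← dist_eq_norm])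
  rw [abs_le] at hj
  have h1 := Int.floor_le (x j / h)
  have h2 := Int.lt_floor_add_one (x j / h)
  have h3 := Int.floor_le (y j / h)
  have h4 := Int.lt_floor_add_one (y j / h)
  simp only [gridCell, Pi.sub_apply, Finset.mem_Icc]
  have h5 : (⌊y j / h⌋ : ℝ) - ⌊x j / h⌋ < R + 1 := by linarith
  have h6 : -((R : ℝ) + 1) < (⌊y j / h⌋ : ℝ) - ⌊x j / h⌋ := by linarith
  have h5' : ⌊y j / h⌋ - ⌊x j / h⌋ < (R : ℤ) + 1 := by exact_mod_cast h5
  have h6' : -((R : ℤ) + 1) < ⌊y j / h⌋ - ⌊x j / h⌋ := by exact_mod_cast h6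
  push_cast
  constructor <;> linarith

end Grid

section Directions

variable {V : Type*} [NormedAddCommGroup V] [NormedSpace ℝ V]

/-- The unit vector pointing from `p` to `q` (zero if `p = q`). -/
noncomputable def direction (p q : V) : V := ‖q - p‖⁻¹ • (q - p)

theorem norm_direction_le_one (p q : V) : ‖direction p q‖ ≤ 1 := by
  rw [direction, norm_smul, norm_inv, norm_norm]
  exact inv_mul_le_one

theorem dist_smul_direction (p q : V) : dist p q • direction p q = q - p := by
  rcases eq_or_ne p q with rfl | h
  · simp
  · have : ‖q - p‖ ≠ 0 := by simpa [sub_eq_zero] using h.symm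
    rw [direction, dist_comm, dist_eq_norm, smul_smul, mul_inv_cancel₀ this, one_smul]

theorem dist_le_of_direction_close {p q q' : V} {η : ℝ}
    (hdir : dist (direction p q) (direction p q') ≤ η) (hle : dist p q' ≤ dist p q) :
    dist q' q ≤ dist p q - (1 - η) * dist p q' := by
  have hsub : q - q' = (dist p q - dist p q') • direction p q
      + dist p q' • (direction p q - direction p q') := by
    rw [smul_sub, sub_smul, dist_smul_direction, dist_smul_direction]
    abel
  rw [dist_comm q' q, dist_eq_norm, hsub]
  refine (norm_add_le _ _).trans ?_
  rw [norm_smul, norm_smul, Real.norm_of_nonneg (sub_nonneg.2 hle),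
    Real.norm_of_nonneg dist_nonneg, ← dist_eq_norm]
  have h1 := mul_le_of_le_one_right (sub_nonneg.2 hle) (norm_direction_le_one p q)
  have h2 := mul_le_mul_of_nonneg_left hdir (dist_nonneg (x := p) (y := q'))
  linarith

end Directions

section Spanner

section Steps

variable {P κ : Type*} [MetricSpace P] {S : Finset P} {col : P → κ} {E : Set (Sym2 P)} {p q z : P}

theorem reach_of_far_edge {q' : P}
    (ih : ∀ x ∈ S, ∀ y ∈ S, col x ≠ col y → dist x y < dist p q → Reach E x y (5 * dist x y))
    (hq : q ∈ S) (hq' : q' ∈ S) (hz : z ∈ S) (hpq' : col p ≠ col q') (hzq : col z ≠ col q)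
    (hE : s(p, q') ∈ E) (hle : dist p q' ≤ dist p q)
    (hdist : dist q' q ≤ dist p q - 3 / 4 * dist p q') (hqz : 4 * dist q z ≤ dist p q') :
    Reach E p q (5 * dist p q) := by
  have hpos : 0 < dist p q' := dist_pos.2 fun h => hpq' (congrArg col h)
  by_cases hc : col q' = col q
  · have htri := dist_triangle q' q z
    have h1 := ih q' hq' z hz (hc ▸ hzq.symm) (by linarith)
    have h2 := ih z hz q hq hzq (by rw [dist_comm z q]; linarith)
    refine ((reach_of_mem hE).trans (h1.trans h2)).mono ?_
    rw [dist_comm z q]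
    linarith
  · have h1 := ih q' hq' q hq hc (by linarith)
    exact ((reach_of_mem hE).trans h1).mono (by linarith)

theorem reach_of_near_edge {b : P} {D : ℝ}
    (ih : ∀ x ∈ S, ∀ y ∈ S, col x ≠ col y → dist x y < dist p q → Reach E x y (5 * dist x y))
    (hq : q ∈ S) (hb : b ∈ S) (hz : z ∈ S) (hzq : col z ≠ col q) (hE : s(p, b) ∈ E)
    (hpos : 0 < dist p q) (hD : 64 * D ≤ dist p q) (hqb : dist q b ≤ D) (hqz : dist q z ≤ D) :
    Reach E p q (5 * dist p q) := by
  have htri := dist_triangle p q b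
  have htri' := dist_triangle_left b z q
  by_cases hc : col b = col q
  · have h1 := ih b hb z hz (hc ▸ hzq.symm) (by linarith)
    have h2 := ih z hz q hq hzq (by rw [dist_comm z q]; linarith)
    refine ((reach_of_mem hE).trans (h1.trans h2)).mono ?_
    rw [dist_comm z q]
    linarith
  · have h1 := ih b hb q hq hc (by rw [dist_comm b q]; linarith)
    refine ((reach_of_mem hE).trans h1).mono ?_
    rw [dist_comm b q]
    linarith

theorem reach_of_three_edges {a b : P} {D : ℝ} (hpb : s(p, b) ∈ E) (hab : s(a, b) ∈ E)
    (hqa : s(q, a) ∈ E) (hD : 64 * D ≤ dist p q) (ha : dist p a ≤ D) (hb : dist q b ≤ D) :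
    Reach E p q (5 * dist p q) := by
  refine ((reach_of_mem hpb).trans ((reach_of_mem hab).symm.trans
    (reach_of_mem hqa).symm)).mono ?_
  have h1 := dist_triangle p q b
  have h2 := dist_triangle q p a
  have h3 := dist_triangle a p b
  rw [dist_comm a p] at h3
  rw [dist_comm q p] at h2
  linarith [dist_nonneg (x := p) (y := a)]

end Steps

theorem sub_log_mem_Icc {r s : ℝ} {K : ℕ} {i : ℤ} (hs : s = 2 ^ i) (hlo : s ≤ 2 ^ K * r)
    (hhi : r < 2 ^ (K + 1) * s) : i - Int.log 2 r ∈ Finset.Icc (-(K : ℤ)) K := by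
  subst hs
  have hspos : (0 : ℝ) < 2 ^ i := by positivity
  have hr : 0 < r := by
    by_contra! h
    have : (2 : ℝ) ^ K * r ≤ 0 := mul_nonpos_of_nonneg_of_nonpos (by positivity) h
    linarith
  have h1 : ((2 : ℕ) : ℝ) ^ Int.log 2 r ≤ r := Int.zpow_log_le_self one_lt_two hr
  have h2 : r < ((2 : ℕ) : ℝ) ^ (Int.log 2 r + 1) := Int.lt_zpow_succ_log_self one_lt_two r
  push_cast at h1 h2
  have h3 : (2 : ℝ) ^ i < 2 ^ ((K : ℤ) + (Int.log 2 r + 1)) := by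
    rw [zpow_add₀ two_ne_zero, zpow_natCast]
    exact hlo.trans_lt (by gcongr)
  have h4 : (2 : ℝ) ^ Int.log 2 r < 2 ^ (((K + 1 : ℕ) : ℤ) + i) := by
    rw [zpow_add₀ two_ne_zero, zpow_natCast]
    exact h1.trans_lt hhi
  rw [zpow_lt_zpow_iff_right₀ one_lt_two] at h3 h4
  push_cast at h4
  rw [Finset.mem_Icc]
  omega

open Classical in
theorem exists_sparse_spanner {d : ℕ} (hd : 1 ≤ d) {κ : Type*}
    (col : EuclideanSpace ℝ (Fin d) → κ) (S : Finset (EuclideanSpace ℝ (Fin d))) :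
    ∃ E : Finset (Sym2 (EuclideanSpace ℝ (Fin d))),
      (∀ e ∈ E, ∃ p ∈ S, ∃ q ∈ S, e = s(p, q) ∧ col p ≠ col q) ∧
      E.card ≤ 16 * (intBox d (576 * d + 1)).card * S.card ∧
      ∀ p ∈ S, ∀ q ∈ S, col p ≠ col q → Reach (E : Set (Sym2 _)) p q (5 * dist p q) := by
  have hd0 : (0 : ℝ) < d := by exact_mod_cast hd
  -- the nearest point of another color
  obtain ⟨f, hf⟩ := exists_argmin_choice
    (fun x : EuclideanSpace ℝ (Fin d) => S.filter fun y => col y ≠ col x) dist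
  simp only [Finset.mem_filter, and_imp] at hf
  set r : EuclideanSpace ℝ (Fin d) → ℝ := fun x => dist x (f x) with hr
  have hr_le {x y} (hy : y ∈ S) (hc : col y ≠ col x) : r x ≤ dist x y := (hf x y hy hc).2
  have hr_lip {x x' y} (hx : col x = col x') (hy : y ∈ S) (hc : col y ≠ col x) :
      r x' ≤ dist x x' + r x := by
    obtain ⟨⟨h1, h2⟩, -⟩ := hf x y hy hc
    have := hr_le (x := x') h1 (hx ▸ h2)
    have h3 := dist_triangle_left x' (f x) x
    simp only [hr] at this ⊢
    linarith
  -- the nearest point of another color in a given cone, among those that are not too close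
  set key : EuclideanSpace ℝ (Fin d) → EuclideanSpace ℝ (Fin d) → Fin d → ℤ :=
    fun x y => gridCell (1 / (4 * d)) (direction x y)
  obtain ⟨Y, hY⟩ := exists_argmin_choice
    (fun i : EuclideanSpace ℝ (Fin d) × (Fin d → ℤ) =>
      S.filter fun y => col y ≠ col i.1 ∧ 4 * r i.1 ≤ dist i.1 y ∧ key i.1 y = i.2)
    (fun i y => dist i.1 y)
  simp only [Finset.mem_filter, and_imp, Prod.forall] at hY
  -- a point of each nonempty set
  obtain ⟨pick, hpick⟩ := exists_argmin_choice
    (fun T : Finset (EuclideanSpace ℝ (Fin d)) => T) (fun _ _ => 0)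
  replace hpick : ∀ {T : Finset (EuclideanSpace ℝ (Fin d))} {y}, y ∈ T → pick T ∈ T :=
    fun {T y} h => (hpick T y h).1
  set cell : ℤ → EuclideanSpace ℝ (Fin d) → Fin d → ℤ :=
    fun i => gridCell (2 ^ i / (64 * d))
  have hcell_dist {i x y} (h : cell i x = cell i y) : dist x y ≤ 2 ^ i / 64 := by
    refine (dist_le_of_gridCell_eq (by positivity) h).trans_eq ?_
    field_simp
  have hcell_mem {i x y} (h : dist x y ≤ 9 * 2 ^ i) :
      cell i y - cell i x ∈ intBox d (576 * d + 1) := by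
    refine gridCell_sub_mem_intBox (by positivity) (h.trans_eq ?_)
    push_cast
    field_simp
    norm_num
  set box := intBox d (576 * d + 1)
  set other : ℤ → (Fin d → ℤ) → κ → EuclideanSpace ℝ (Fin d) :=
    fun i v c => pick (S.filter fun y => cell i y = v ∧ col y ≠ c)
  have hother_spec {i y c} (hy : y ∈ S) (hc : col y ≠ c) :
      other i (cell i y) c ∈ S ∧ cell i (other i (cell i y) c) = cell i y ∧
        col (other i (cell i y) c) ≠ c :=
    Finset.mem_filter.1
      (hpick (Finset.mem_filter.2 ⟨hy, rfl, hc⟩ :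
        y ∈ S.filter fun x => cell i x = cell i y ∧ col x ≠ c))
  set far := (S ×ˢ box).image fun a => s(a.1, Y (a.1, a.2))
  set near := (S ×ˢ Finset.Icc (-7 : ℤ) 7 ×ˢ box).image fun a =>
    s(a.1, other (Int.log 2 (r a.1) + a.2.1) (cell (Int.log 2 (r a.1) + a.2.1) a.1 + a.2.2)
      (col a.1))
  set E := (far ∪ near).filter fun e => ∃ p ∈ S, ∃ q ∈ S, e = s(p, q) ∧ col p ≠ col q
  have mem_far {x y} (hx : x ∈ S) (hy : y ∈ S) (hc : col x ≠ col y) (h : 4 * r x ≤ dist x y) :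
      s(x, Y (x, key x y)) ∈ (E : Set (Sym2 _)) := by
    obtain ⟨⟨h1, h2, -⟩, -⟩ := hY x (key x y) y hy hc.symm h rfl
    refine Finset.mem_coe.2 (Finset.mem_filter.2 ⟨Finset.mem_union_left _ ?_,
      x, hx, _, h1, rfl, h2.symm⟩)
    refine Finset.mem_image.2 ⟨(x, key x y), Finset.mem_product.2 ⟨hx, ?_⟩, rfl⟩
    have h0 : gridCell (1 / (4 * (d : ℝ))) (0 : EuclideanSpace ℝ (Fin d)) = 0 := by
      ext j; simp [gridCell]
    have := gridCell_sub_mem_intBox (h := 1 / (4 * (d : ℝ))) (by positivity) (R := 576 * d)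
      (x := 0) (y := direction x y) (by
        rw [dist_zero_left]
        refine (norm_direction_le_one x y).trans ?_
        push_cast
        field_simp
        norm_num)
    rwa [h0, sub_zero] at this
  have mem_near {x y i} (hx : x ∈ S) (hy : y ∈ S) (hc : col x ≠ col y)
      (h : dist x y ≤ 9 * 2 ^ i) (hlo : (2 : ℝ) ^ i ≤ 128 * r x)
      (hhi : r x < 256 * 2 ^ i) :
      s(x, other i (cell i y) (col x)) ∈ (E : Set (Sym2 _)) := by
    obtain ⟨h1, -, h2⟩ := hother_spec (i := i) hy hc.symm
    refine Finset.mem_coe.2 (Finset.mem_filter.2 ⟨Finset.mem_union_right _ ?_,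
      x, hx, _, h1, rfl, h2.symm⟩)
    refine Finset.mem_image.2 ⟨(x, i - Int.log 2 (r x), cell i y - cell i x),
      Finset.mem_product.2 ⟨hx, Finset.mem_product.2
        ⟨sub_log_mem_Icc (K := 7) rfl (hlo.trans_eq (by norm_num))
          (hhi.trans_eq (by norm_num)), hcell_mem h⟩⟩, ?_⟩
    simp
  refine ⟨E, fun e he => (Finset.mem_filter.1 he).2, ?_, ?_⟩
  · have h1 : far.card ≤ S.card * box.card := by
      simpa using Finset.card_image_le (s := S ×ˢ box) (f := fun a => s(a.1, Y (a.1, a.2)))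
    have h2 : near.card ≤ S.card * (15 * box.card) := by
      refine Finset.card_image_le.trans_eq ?_
      simp
    calc E.card ≤ (far ∪ near).card := Finset.card_filter_le _ _
      _ ≤ far.card + near.card := Finset.card_union_le _ _
      _ ≤ S.card * box.card + S.card * (15 * box.card) := add_le_add h1 h2
      _ = _ := by ring
  have step {p q} (hp : p ∈ S) (hq : q ∈ S) (hc : col p ≠ col q) (hrpq : r q ≤ r p)
      (ih : ∀ x ∈ S, ∀ y ∈ S, col x ≠ col y → dist x y < dist p q →
        Reach (E : Set (Sym2 _)) x y (5 * dist x y)) :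
      Reach (E : Set (Sym2 _)) p q (5 * dist p q) := by
    have hpos : 0 < dist p q := dist_pos.2 fun h => hc (congrArg col h)
    obtain ⟨⟨hfS, hfc⟩, -⟩ := hf q p hp hc
    rcases le_or_gt (4 * r p) (dist p q) with hlong | hshort
    · obtain ⟨⟨h1, h2, h3, h4⟩, h5⟩ := hY p (key p q) q hq hc.symm hlong rfl
      have hdir := dist_le_of_gridCell_eq (by positivity) h4
      have := dist_le_of_direction_close (q := q) (η := 1 / 4) (by
        rw [dist_comm]
        refine hdir.trans_eq ?_
        field_simp) h5
      exact reach_of_far_edge ih hq h1 hfS h2.symm hfc (mem_far hp hq hc hlong) h5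
        (by linarith) (by simp only [hr] at h3 hrpq; linarith)
    have hrp : 0 < r p := by linarith
    set i := Int.log 2 (r p)
    have hlo : ((2 : ℕ) : ℝ) ^ i ≤ r p := Int.zpow_log_le_self one_lt_two hrp
    have hhi : r p < ((2 : ℕ) : ℝ) ^ (i + 1) := Int.lt_zpow_succ_log_self one_lt_two _
    rw [zpow_add_one₀ (by norm_num)] at hhi
    push_cast at hlo hhi
    have hspos : (0 : ℝ) < 2 ^ i := by positivity
    have hrle : r p ≤ dist p q := hr_le hq hc.symm
    have hpb := mem_near (i := i) hp hq hc (by linarith) (by linarith) (by linarith)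
    obtain ⟨hbS, hbcell, hbc⟩ := hother_spec (i := i) hq hc.symm
    have hqb := hcell_dist hbcell.symm
    rcases le_or_gt (r q) (2 ^ i / 64) with hclose | hisol
    · exact reach_of_near_edge ih hq hbS hfS hfc hpb hpos (by linarith) hqb hclose
    have mono {x y} (hx : 2 ^ i / 64 < r x) (hy : y ∈ S) (hcy : cell i y = cell i x) :
        col y = col x := by
      by_contra hne
      have := hr_le hy hne
      have := hcell_dist hcy.symm
      linarith
    have hqa := mem_near (i := i) hq hp hc.symm (by rw [dist_comm]; linarith) (by linarith)
      (by linarith)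
    obtain ⟨haS, hacell, -⟩ := hother_spec (i := i) hp hc
    have hpa := hcell_dist hacell.symm
    have hac : col (other i (cell i p) (col q)) = col p := mono (by linarith) haS hacell
    have hbc' : col (other i (cell i q) (col p)) = col q := mono hisol hbS hbcell
    set a := other i (cell i p) (col q)
    set b := other i (cell i q) (col p)
    have h1 := hr_lip hac.symm hq hc.symm
    have h2 := hr_lip hac hq (hac ▸ hc.symm)
    have h3 := dist_triangle_left a q p
    rw [dist_comm a p] at h2
    have hab := mem_near (i := i) haS hq (hac ▸ hc) (by linarith) (by linarith) (by linarith)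
    rw [hac] at hab
    exact reach_of_three_edges hpb hab hqa (by linarith) hpa hqb
  have main := Finset.strong_induction_real (S ×ˢ S) (fun x => dist x.1 x.2)
    (Q := fun x => col x.1 ≠ col x.2 → Reach (E : Set (Sym2 _)) x.1 x.2 (5 * dist x.1 x.2))
    (by
      rintro ⟨p, q⟩ hmem ih hc
      obtain ⟨hp, hq⟩ := Finset.mem_product.1 hmem
      have ih' : ∀ x ∈ S, ∀ y ∈ S, col x ≠ col y → dist x y < dist p q →
          Reach (E : Set (Sym2 _)) x y (5 * dist x y) :=
        fun x hx y hy hxy hlt => ih (x, y) (Finset.mem_product.2 ⟨hx, hy⟩) hlt hxy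
      rcases le_total (r q) (r p) with h | h
      · exact step hp hq hc h ih'
      · have := step hq hp (Ne.symm hc) h (by rwa [dist_comm q p])
        rw [dist_comm q p] at this
        exact this.symm)
  exact fun p hp q hq hc => main (p, q) (Finset.mem_product.2 ⟨hp, hq⟩) hc

end Spanner

/-- For every dimension `d ≥ 1` and every `0 < ε < 1` there is a constant `C`
such that for every `k ≥ 2`, every finite set `S` of `n` points in `ℝ^d` and
every partition of `S` into `k` subsets, the complete `k`-partite geometric
graph on `S` has a `(5+ε)`-spanner with at most `C·n` edges. -/
theorem five_plus_eps_spanner (d : ℕ) (hd : 1 ≤ d) (ε : ℝ) (hε0 : 0 < ε) (hε1 : ε < 1) :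
    ∃ C : ℝ, ∀ k : ℕ, 2 ≤ k →
      ∀ (S : Finset (EuclideanSpace ℝ (Fin d)))
        (Cl : Fin k → Set (EuclideanSpace ℝ (Fin d))),
        (∀ i j, i ≠ j → Disjoint (Cl i) (Cl j)) →
        (⋃ i, Cl i) = ↑S →
        ∃ E : Finset (Sym2 (EuclideanSpace ℝ (Fin d))),
          (↑E : Set (Sym2 (EuclideanSpace ℝ (Fin d)))) ⊆ kpartiteEdges Cl ∧
          (E.card : ℝ) ≤ C * S.card ∧
          ∀ p ∈ S, ∀ q ∈ S,
            gdist (↑E : Set (Sym2 (EuclideanSpace ℝ (Fin d)))) p q ≤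
              ENNReal.ofReal (5 + ε) * gdist (kpartiteEdges Cl) p q := by
  classical
  refine ⟨16 * (intBox d (576 * d + 1)).card, fun k hk S Cl hdisj hunion => ?_⟩
  have hcover : ∀ x, ∃ i : Fin k, x ∈ S → x ∈ Cl i := by
    intro x
    by_cases hx : x ∈ S
    · obtain ⟨i, hi⟩ := Set.mem_iUnion.1 (hunion ▸ Finset.mem_coe.2 hx : x ∈ ⋃ i, Cl i)
      exact ⟨i, fun _ => hi⟩
    · exact ⟨⟨0, by omega⟩, fun h => absurd h hx⟩
  choose col hcol using hcover
  have hS {x i} (hx : x ∈ Cl i) : x ∈ S :=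
    Finset.mem_coe.1 (hunion ▸ Set.mem_iUnion.2 ⟨i, hx⟩)
  have hcol_eq {x i} (hx : x ∈ Cl i) : col x = i := by
    by_contra hne
    exact Set.disjoint_left.1 (hdisj _ _ hne) (hcol x (hS hx)) hx
  obtain ⟨E, hsub, hcard, hreach⟩ := exists_sparse_spanner hd col S
  refine ⟨E, ?_, by exact_mod_cast hcard, ?_⟩
  · intro e he
    obtain ⟨p, hp, q, hq, rfl, hc⟩ := hsub e he
    exact ⟨p, q, rfl, _, _, hc, hcol p hp, hcol q hq⟩
  · intro p _ q _
    refine le_mul_gdist (by simp; linarith) ENNReal.ofReal_ne_top gdist_self gdist_triangle ?_ p q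
    rintro x y ⟨x', y', hxy, i, j, hij, hx, hy⟩
    have hbound : gdist (E : Set (Sym2 _)) x' y' ≤ ENNReal.ofReal (5 + ε) * edist x' y' := by
      rw [edist_dist, ← ENNReal.ofReal_mul (by linarith)]
      refine ((hreach x' (hS hx) y' (hS hy) ?_).mono ?_).2
      · rwa [hcol_eq hx, hcol_eq hy]
      · gcongr
        linarith
    rcases Sym2.eq_iff.1 hxy with ⟨rfl, rfl⟩ | ⟨rfl, rfl⟩
    · exact hbound
    · rw [edist_comm]
      exact (gdist_comm_le _ _).trans hbound
end

section
/- Let s > 0 be a real number and let X and Y be two finite nonempty point sets in ℝ^d that are well-separated with respect to s. If p, p', p'' ∈ X and q ∈ Y, then |p'p''| ≤ (2/s)·|pq|. -/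
/-- The axes-parallel bounding box of a set `X ⊆ ℝ^d`: the smallest
axes-parallel hyperrectangle containing `X`, described coordinatewise via the
infimum and supremum of each coordinate over `X`. -/
def boundingBox {d : ℕ} (X : Set (EuclideanSpace ℝ (Fin d))) :
    Set (EuclideanSpace ℝ (Fin d)) :=
  {p | ∀ i : Fin d, sInf ((fun x => x i) '' X) ≤ p i ∧ p i ≤ sSup ((fun x => x i) '' X)}

/-- `X` and `Y` are well-separated with respect to `s`: there are two closed
balls of the same radius `ρ`, one containing the bounding box of `X`, the other
containing the bounding box of `Y`, at distance at least `s·ρ` from each other. -/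
def WellSeparated {d : ℕ} (s : ℝ) (X Y : Set (EuclideanSpace ℝ (Fin d))) : Prop :=
  ∃ (c₁ c₂ : EuclideanSpace ℝ (Fin d)) (ρ : ℝ), 0 ≤ ρ ∧
    boundingBox X ⊆ Metric.closedBall c₁ ρ ∧
    boundingBox Y ⊆ Metric.closedBall c₂ ρ ∧
    ∀ x ∈ Metric.closedBall c₁ ρ, ∀ y ∈ Metric.closedBall c₂ ρ, s * ρ ≤ dist x y

theorem subset_boundingBox {d : ℕ} {X : Set (EuclideanSpace ℝ (Fin d))} (hX : X.Finite) :
    X ⊆ boundingBox X := fun _ hx _ =>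
  ⟨csInf_le (hX.image _).bddBelow (Set.mem_image_of_mem _ hx),
    le_csSup (hX.image _).bddAbove (Set.mem_image_of_mem _ hx)⟩

/-- If `X` and `Y` are finite nonempty point sets in `ℝ^d` that are
well-separated with respect to `s > 0`, `p, p', p'' ∈ X` and `q ∈ Y`, then
`|p'p''| ≤ (2/s)·|pq|`. -/
theorem dist_within_le {d : ℕ} (s : ℝ) (hs : 0 < s)
    (X Y : Set (EuclideanSpace ℝ (Fin d))) (hXfin : X.Finite) (hYfin : Y.Finite)
    (hXne : X.Nonempty) (hYne : Y.Nonempty) (hWS : WellSeparated s X Y)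
    (p p' p'' q : EuclideanSpace ℝ (Fin d))
    (hp : p ∈ X) (hp' : p' ∈ X) (hp'' : p'' ∈ X) (hq : q ∈ Y) :
    dist p' p'' ≤ (2 / s) * dist p q := by
  obtain ⟨c₁, c₂, ρ, -, hX, hY, hsep⟩ := hWS
  have hXball := (subset_boundingBox hXfin).trans hX
  have hpq : s * ρ ≤ dist p q := hsep p (hXball hp) q (hY (subset_boundingBox hYfin hq))
  have hdiam : dist p' p'' ≤ ρ + ρ :=
    (dist_triangle_right p' p'' c₁).trans (add_le_add (hXball hp') (hXball hp''))
  rw [div_mul_eq_mul_div, le_div_iff₀ hs]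
  nlinarith
end

section
/- Let s > 0 be a real number and let X and Y be two finite nonempty point sets in ℝ^d that are well-separated with respect to s. If p, p' ∈ X and q, q' ∈ Y, then |p'q'| ≤ (1 + 4/s)·|pq|. -/
/-- If `X` and `Y` are finite nonempty point sets in `ℝ^d` that are
well-separated with respect to `s > 0`, `p, p' ∈ X` and `q, q' ∈ Y`, then
`|p'q'| ≤ (1 + 4/s)·|pq|`. -/
theorem dist_between_le {d : ℕ} (s : ℝ) (hs : 0 < s)
    (X Y : Set (EuclideanSpace ℝ (Fin d))) (hXfin : X.Finite) (hYfin : Y.Finite)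
    (hXne : X.Nonempty) (hYne : Y.Nonempty) (hWS : WellSeparated s X Y)
    (p p' q q' : EuclideanSpace ℝ (Fin d))
    (hp : p ∈ X) (hp' : p' ∈ X) (hq : q ∈ Y) (hq' : q' ∈ Y) :
    dist p' q' ≤ (1 + 4 / s) * dist p q := by
  obtain ⟨c₁, c₂, ρ, -, hX, hY, hsep⟩ := hWS
  have hX' := (subset_boundingBox hXfin).trans hX
  have hY' := (subset_boundingBox hYfin).trans hY
  have hpp : dist p' p ≤ 2 * ρ := by
    linarith [dist_triangle_right p' p c₁, Metric.mem_closedBall.1 (hX' hp),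
      Metric.mem_closedBall.1 (hX' hp')]
  have hqq : dist q q' ≤ 2 * ρ := by
    linarith [dist_triangle_right q q' c₂, Metric.mem_closedBall.1 (hY' hq),
      Metric.mem_closedBall.1 (hY' hq')]
  have hρ : ρ ≤ dist p q / s := by
    rw [le_div_iff₀' hs]
    exact hsep p (hX' hp) q (hY' hq)
  calc dist p' q' ≤ dist p' p + dist p q + dist q q' := dist_triangle4 _ _ _ _
    _ ≤ dist p q + 4 * (dist p q / s) := by linarith
    _ = (1 + 4 / s) * dist p q := by ring
end

section
/- For every integer d ≥ 1 and every real s > 0, there exists a constant C (depending only on d and s) such that every set S of n points in ℝ^d admits a well-separated pair decomposition with separation constant s consisting of at most C·n pairs. -/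
/-- A well-separated pair decomposition of a finite set `S ⊆ ℝ^d` with
separation constant `s`: a finite set of unordered pairs `{X, Y}` of nonempty
subsets of `S`, each pair well-separated with respect to `s`, such that for
every two distinct points `p, q ∈ S` there is exactly one pair `{X, Y}` of the
collection with `p ∈ X` and `q ∈ Y`. -/
def IsWSPD {d : ℕ} (s : ℝ) (S : Finset (EuclideanSpace ℝ (Fin d)))
    (W : Finset (Sym2 (Set (EuclideanSpace ℝ (Fin d))))) : Prop :=
  (∀ e ∈ W, ∀ X Y : Set (EuclideanSpace ℝ (Fin d)), e = s(X, Y) →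
      X.Nonempty ∧ Y.Nonempty ∧ X ⊆ ↑S ∧ Y ⊆ ↑S ∧ WellSeparated s X Y) ∧
  (∀ p ∈ S, ∀ q ∈ S, p ≠ q →
      ∃! e, e ∈ W ∧ ∃ X Y : Set (EuclideanSpace ℝ (Fin d)),
        e = s(X, Y) ∧ p ∈ X ∧ q ∈ Y)

theorem boundingBox_subset_closedBall {d : ℕ} {X : Set (EuclideanSpace ℝ (Fin d))}
    (hX : X.Nonempty) {p : EuclideanSpace ℝ (Fin d)} {δ : ℝ}
    (h : ∀ x ∈ X, ∀ i, |x i - p i| ≤ δ) :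
    boundingBox X ⊆ Metric.closedBall p (√d * δ) := by
  obtain ⟨x₀, hx₀⟩ := hX
  intro y hy
  have hyp : ∀ i, |y i - p i| ≤ δ := by
    intro i
    have hne : ((fun x : EuclideanSpace ℝ (Fin d) => x i) '' X).Nonempty := ⟨_, x₀, hx₀, rfl⟩
    have h₁ : p i - δ ≤ sInf ((fun x : EuclideanSpace ℝ (Fin d) => x i) '' X) := by
      refine le_csInf hne ?_
      rintro _ ⟨x, hx, rfl⟩
      have := (abs_le.1 (h x hx i)).1
      dsimp only
      linarith
    have h₂ : sSup ((fun x : EuclideanSpace ℝ (Fin d) => x i) '' X) ≤ p i + δ := by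
      refine csSup_le hne ?_
      rintro _ ⟨x, hx, rfl⟩
      have := (abs_le.1 (h x hx i)).2
      dsimp only
      linarith
    have := hy i
    exact abs_le.2 ⟨by linarith, by linarith⟩
  rcases Nat.eq_zero_or_pos d with rfl | hd
  · simp [Subsingleton.elim y p]
  have hδ : 0 ≤ δ := (abs_nonneg _).trans (hyp ⟨0, hd⟩)
  rw [Metric.mem_closedBall, EuclideanSpace.dist_eq]
  refine Real.sqrt_le_iff.2 ⟨by positivity, ?_⟩
  rw [mul_pow, Real.sq_sqrt (Nat.cast_nonneg d)]
  calc ∑ i, dist (y i) (p i) ^ 2 ≤ ∑ _i : Fin d, δ ^ 2 := by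
        gcongr
        exact hyp _
    _ = d * δ ^ 2 := by simp

theorem WellSeparated.symm {d : ℕ} {s : ℝ} {X Y : Set (EuclideanSpace ℝ (Fin d))}
    (h : WellSeparated s X Y) : WellSeparated s Y X := by
  obtain ⟨c₁, c₂, ρ, hρ, h₁, h₂, h₃⟩ := h
  exact ⟨c₂, c₁, ρ, hρ, h₂, h₁, fun x hx y hy => dist_comm x y ▸ h₃ y hy x hx⟩

theorem wellSeparated_comm {d : ℕ} {s : ℝ} {X Y : Set (EuclideanSpace ℝ (Fin d))} :
    WellSeparated s X Y ↔ WellSeparated s Y X := ⟨.symm, .symm⟩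

theorem wellSeparated_of_le_dist {d : ℕ} {s : ℝ} {X Y : Set (EuclideanSpace ℝ (Fin d))}
    (hX : X.Nonempty) (hY : Y.Nonempty) {p q : EuclideanSpace ℝ (Fin d)} {δ : ℝ} (hδ : 0 ≤ δ)
    (hp : ∀ x ∈ X, ∀ i, |x i - p i| ≤ δ) (hq : ∀ y ∈ Y, ∀ i, |y i - q i| ≤ δ)
    (h : (s + 2) * (√d * δ) ≤ dist p q) : WellSeparated s X Y := by
  refine ⟨p, q, √d * δ, by positivity, boundingBox_subset_closedBall hX hp,
    boundingBox_subset_closedBall hY hq, fun x hx y hy => ?_⟩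
  rw [Metric.mem_closedBall] at hx hy
  have h₁ := dist_triangle4 p x y q
  rw [dist_comm p x] at h₁
  linarith

theorem not_wellSeparated_self {d : ℕ} {s : ℝ} (hs : 0 < s)
    {X : Set (EuclideanSpace ℝ (Fin d))} (hX : X.Finite) (hX' : X.Nontrivial) :
    ¬ WellSeparated s X X := by
  rintro ⟨c₁, c₂, ρ, hρ, h₁, h₂, h₃⟩
  obtain ⟨p, hp, q, hq, hpq⟩ := hX'
  have hb := subset_boundingBox hX
  have h₄ := h₃ p (h₁ (hb hp)) p (h₂ (hb hp))
  rw [dist_self] at h₄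
  obtain rfl : ρ = 0 := by nlinarith
  rw [Metric.closedBall_zero] at h₁
  exact hpq ((h₁ (hb hp)).trans (h₁ (hb hq)).symm)

/-- The points of `S` that are mapped to `z` by the labelling `c k` of level `k`. -/
def levelCell {α β : Type*} (S : Finset α) (c : ℕ → α → β) (k : ℕ) (z : β) : Set α :=
  {x | x ∈ S ∧ c k x = z}

section Hierarchy

variable {α β : Type*} {c : ℕ → α → β}

theorem label_eq_of_le (hc : ∀ k x y, c (k + 1) x = c (k + 1) y → c k x = c k y)
    {j k : ℕ} (hjk : j ≤ k) {x y : α} (h : c k x = c k y) : c j x = c j y := by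
  induction hjk with
  | refl => exact h
  | step _ ih => exact ih (hc _ _ _ h)

/-- In a hierarchy of partitions of `S`, the cells that get split can be injectively labelled by
points of `S`: there is one level `κ r` for each point `r` such that every cell splitting
between levels `k` and `k + 1` contains a point `r ∈ S` with `κ r = k + 1`. -/
theorem exists_split_level (S : Finset α)
    (hc : ∀ k x y, c (k + 1) x = c (k + 1) y → c k x = c k y) :
    ∃ κ : α → ℕ, ∀ k, ∀ p ∈ S,
      levelCell S c k (c k p) ≠ levelCell S c (k + 1) (c (k + 1) p) →
      ∃ r ∈ S, c k r = c k p ∧ κ r = k + 1 := by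
  obtain ⟨e, he⟩ := Set.countable_iff_exists_injOn.1 S.countable_toSet
  refine ⟨fun r => sInf {k | ∀ x ∈ S, c k x = c k r → e r ≤ e x}, fun k p hp hne => ?_⟩
  classical
  obtain ⟨x, hx, hxk, hxk'⟩ : ∃ x ∈ S, c k x = c k p ∧ c (k + 1) x ≠ c (k + 1) p := by
    by_contra! hcon
    refine hne (Set.ext fun x => ⟨fun h => ⟨h.1, hcon x h.1 h.2⟩, fun h => ⟨h.1, hc _ _ _ h.2⟩⟩)
  have hmin : ∀ j, ∀ y ∈ S, ∃ m ∈ S, c j m = c j y ∧ ∀ z ∈ S, c j z = c j y → e m ≤ e z := by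
    intro j y hy
    obtain ⟨m, hm, hm'⟩ := (S.filter fun z => c j z = c j y).exists_min_image e
      ⟨y, by simp [hy]⟩
    rw [Finset.mem_filter] at hm
    exact ⟨m, hm.1, hm.2, fun z hz hzy => hm' z (Finset.mem_filter.2 ⟨hz, hzy⟩)⟩
  obtain ⟨m, hm, hmp, hm'⟩ := hmin k p hp
  obtain ⟨y, hy, hyp, hym⟩ : ∃ y ∈ S, c k y = c k p ∧ c (k + 1) y ≠ c (k + 1) m := by
    by_cases h : c (k + 1) p = c (k + 1) m
    · exact ⟨x, hx, hxk, h ▸ hxk'⟩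
    · exact ⟨p, hp, rfl, h⟩
  obtain ⟨r, hr, hry, hr'⟩ := hmin (k + 1) y hy
  have hrp : c k r = c k p := (hc _ _ _ hry).trans hyp
  have hmem : k + 1 ∈ {k | ∀ x ∈ S, c k x = c k r → e r ≤ e x} :=
    fun z hz hzr => hr' z hz (hzr.trans hry)
  refine ⟨r, hr, hrp, le_antisymm (Nat.sInf_le hmem) ?_⟩
  refine le_csInf ⟨_, hmem⟩ fun j hj => ?_
  by_contra! hjk
  have h₁ : e r ≤ e m :=
    hj m hm (label_eq_of_le hc (Nat.lt_succ_iff.1 hjk) (hmp.trans hrp.symm))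
  have h₂ : e m ≤ e r := hm' r hr hrp
  have h₃ : r = m := he hr hm (le_antisymm h₁ h₂)
  exact hym (h₃ ▸ hry.symm)

end Hierarchy

section Decomposition

variable {d : ℕ} {β : Type*}

/-- The first level at which the cells of `p` and `q` are well-separated. -/
noncomputable def sepLevel (s : ℝ) (S : Finset (EuclideanSpace ℝ (Fin d)))
    (c : ℕ → EuclideanSpace ℝ (Fin d) → β) (p q : EuclideanSpace ℝ (Fin d)) : ℕ :=
  sInf {k | WellSeparated s (levelCell S c k (c k p)) (levelCell S c k (c k q))}

/-- The pair of cells containing `p` and `q` at the first level at which they are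
well-separated. -/
noncomputable def sepPair (s : ℝ) (S : Finset (EuclideanSpace ℝ (Fin d)))
    (c : ℕ → EuclideanSpace ℝ (Fin d) → β) (p q : EuclideanSpace ℝ (Fin d)) :
    Sym2 (Set (EuclideanSpace ℝ (Fin d))) :=
  s(levelCell S c (sepLevel s S c p q) (c (sepLevel s S c p q) p),
    levelCell S c (sepLevel s S c p q) (c (sepLevel s S c p q) q))

variable {s : ℝ} {S : Finset (EuclideanSpace ℝ (Fin d))}
  {c : ℕ → EuclideanSpace ℝ (Fin d) → β} {p q p' q' : EuclideanSpace ℝ (Fin d)}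

theorem wellSeparated_sepLevel
    (h : ∃ k, WellSeparated s (levelCell S c k (c k p)) (levelCell S c k (c k q))) :
    WellSeparated s (levelCell S c (sepLevel s S c p q) (c (sepLevel s S c p q) p))
      (levelCell S c (sepLevel s S c p q) (c (sepLevel s S c p q) q)) :=
  Nat.sInf_mem h

theorem sepLevel_comm : sepLevel s S c p q = sepLevel s S c q p := by
  simp only [sepLevel, wellSeparated_comm]

theorem sepPair_comm : sepPair s S c p q = sepPair s S c q p := by
  rw [sepPair, sepPair, sepLevel_comm, Sym2.eq_swap]

theorem sepPair_congr (hc : ∀ k x y, c (k + 1) x = c (k + 1) y → c k x = c k y)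
    (h : ∃ k, WellSeparated s (levelCell S c k (c k p)) (levelCell S c k (c k q)))
    (hp : c (sepLevel s S c p q) p' = c (sepLevel s S c p q) p)
    (hq : c (sepLevel s S c p q) q' = c (sepLevel s S c p q) q) :
    sepPair s S c p' q' = sepPair s S c p q := by
  have hlevel : sepLevel s S c p' q' = sepLevel s S c p q := by
    have hmem : WellSeparated s (levelCell S c (sepLevel s S c p q) (c (sepLevel s S c p q) p'))
        (levelCell S c (sepLevel s S c p q) (c (sepLevel s S c p q) q')) := by
      rw [hp, hq]
      exact wellSeparated_sepLevel h
    have hle : sepLevel s S c p' q' ≤ sepLevel s S c p q := Nat.sInf_le hmem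
    refine le_antisymm hle (Nat.sInf_le ?_)
    have := wellSeparated_sepLevel ⟨_, hmem⟩
    rwa [label_eq_of_le hc hle hp, label_eq_of_le hc hle hq] at this
  rw [sepPair, sepPair, hlevel, hp, hq]

open Classical in
theorem isWSPD_image_sepPair (hc : ∀ k x y, c (k + 1) x = c (k + 1) y → c k x = c k y)
    (hsep : ∀ p ∈ S, ∀ q ∈ S, p ≠ q →
      ∃ k, WellSeparated s (levelCell S c k (c k p)) (levelCell S c k (c k q))) :
    IsWSPD s S (S.offDiag.image fun x => sepPair s S c x.1 x.2) := by
  constructor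
  · intro e he X Y hXY
    obtain ⟨⟨p, q⟩, hpq, rfl⟩ := Finset.mem_image.1 he
    obtain ⟨hp, hq, hne⟩ := Finset.mem_offDiag.1 hpq
    have hw := wellSeparated_sepLevel (hsep p hp q hq hne)
    have hsub : ∀ k z, levelCell S c k z ⊆ ↑S := fun _ _ _ hx => hx.1
    rcases Sym2.eq_iff.1 hXY with ⟨rfl, rfl⟩ | ⟨rfl, rfl⟩
    · exact ⟨⟨p, hp, rfl⟩, ⟨q, hq, rfl⟩, hsub _ _, hsub _ _, hw⟩
    · exact ⟨⟨q, hq, rfl⟩, ⟨p, hp, rfl⟩, hsub _ _, hsub _ _, hw.symm⟩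
  · intro p hp q hq hne
    refine ⟨sepPair s S c p q, ⟨Finset.mem_image.2 ⟨(p, q), by simp [hp, hq, hne], rfl⟩,
      _, _, rfl, ⟨hp, rfl⟩, ⟨hq, rfl⟩⟩, ?_⟩
    rintro e ⟨he, X, Y, hXY, hpX, hqY⟩
    obtain ⟨⟨a, b⟩, hab, rfl⟩ := Finset.mem_image.1 he
    obtain ⟨ha, hb, hne'⟩ := Finset.mem_offDiag.1 hab
    have hw := hsep a ha b hb hne'
    rcases Sym2.eq_iff.1 hXY with ⟨rfl, rfl⟩ | ⟨rfl, rfl⟩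
    · exact (sepPair_congr hc hw hpX.2 hqY.2).symm
    · rw [sepPair_comm (p := p)]
      exact (sepPair_congr hc hw hqY.2 hpX.2).symm

end Decomposition

/-- The index of the dyadic cube of side `h / 2 ^ k` containing `x + (a, …, a)`. -/
noncomputable def gridLabel {d : ℕ} (a h : ℝ) (k : ℕ) (x : EuclideanSpace ℝ (Fin d)) :
    Fin d → ℤ :=
  fun i => ⌊2 ^ k * ((x i + a) / h)⌋

section Grid

variable {d : ℕ} {a h : ℝ} {k : ℕ} {x y : EuclideanSpace ℝ (Fin d)}

theorem gridLabel_eq_of_succ (hxy : gridLabel a h (k + 1) x = gridLabel a h (k + 1) y) :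
    gridLabel a h k x = gridLabel a h k y := by
  have key : ∀ (z : EuclideanSpace ℝ (Fin d)) i,
      gridLabel a h k z i = gridLabel a h (k + 1) z i / 2 := by
    intro z i
    simp only [gridLabel]
    have h₁ := Int.floor_div_natCast ((2 : ℝ) ^ (k + 1) * ((z i + a) / h)) 2
    rw [Nat.cast_ofNat, Nat.cast_ofNat] at h₁
    rw [← h₁]
    congr 1
    ring
  funext i
  rw [key, key, hxy]

theorem abs_sub_le_of_gridLabel_eq (hh : 0 < h) (hxy : gridLabel a h k x = gridLabel a h k y)
    (i : Fin d) : |x i - y i| ≤ h / 2 ^ k := by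
  have h₁ := (Int.abs_sub_lt_one_of_floor_eq_floor (congrFun hxy i)).le
  have h₂ : (2 : ℝ) ^ k * ((x i + a) / h) - 2 ^ k * ((y i + a) / h) =
      (x i - y i) / (h / 2 ^ k) := by
    field_simp
    ring
  rwa [h₂, abs_div, abs_of_pos (by positivity : 0 < h / 2 ^ k), div_le_one (by positivity)] at h₁

theorem abs_gridLabel_sub_le (hh : 0 < h) {i : Fin d} {M : ℕ}
    (hxy : |x i - y i| ≤ M * (h / 2 ^ k)) :
    |gridLabel a h k x i - gridLabel a h k y i| ≤ M := by
  have h₂ : (2 : ℝ) ^ k * ((x i + a) / h) - 2 ^ k * ((y i + a) / h) =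
      (x i - y i) / (h / 2 ^ k) := by
    field_simp
    ring
  have h₁ : |(2 : ℝ) ^ k * ((x i + a) / h) - 2 ^ k * ((y i + a) / h)| ≤ M := by
    rw [h₂, abs_div, abs_of_pos (by positivity : 0 < h / 2 ^ k)]
    exact (div_le_iff₀ (by positivity)).2 hxy
  simp only [gridLabel]
  generalize (2 : ℝ) ^ k * ((x i + a) / h) = u at h₁
  generalize (2 : ℝ) ^ k * ((y i + a) / h) = v at h₁
  obtain ⟨h₃, h₄⟩ := abs_le.1 h₁
  have hu := Int.floor_le u
  have hu' := Int.lt_floor_add_one u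
  have hv := Int.floor_le v
  have hv' := Int.lt_floor_add_one v
  have h₅ : ⌊u⌋ - ⌊v⌋ < (M : ℤ) + 1 := by
    exact_mod_cast (by linarith : (⌊u⌋ : ℝ) - ⌊v⌋ < (M : ℝ) + 1)
  have h₆ : ⌊v⌋ - ⌊u⌋ < (M : ℤ) + 1 := by
    exact_mod_cast (by linarith : (⌊v⌋ : ℝ) - ⌊u⌋ < (M : ℝ) + 1)
  exact abs_le.2 ⟨by omega, by omega⟩

theorem wellSeparated_of_le_dist_gridLabel {s : ℝ} {S : Finset (EuclideanSpace ℝ (Fin d))}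
    (hh : 0 < h) (hx : x ∈ S) (hy : y ∈ S) (hxy : (s + 2) * (√d * (h / 2 ^ k)) ≤ dist x y) :
    WellSeparated s (levelCell S (gridLabel a h) k (gridLabel a h k x))
      (levelCell S (gridLabel a h) k (gridLabel a h k y)) :=
  wellSeparated_of_le_dist ⟨x, hx, rfl⟩ ⟨y, hy, rfl⟩ (by positivity)
    (fun _ hz => abs_sub_le_of_gridLabel_eq hh hz.2)
    (fun _ hz => abs_sub_le_of_gridLabel_eq hh hz.2) hxy

theorem exists_wellSeparated_gridLabel {s : ℝ} {S : Finset (EuclideanSpace ℝ (Fin d))}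
    (hh : 0 < h) (hx : x ∈ S) (hy : y ∈ S) (hxy : x ≠ y) :
    ∃ k, WellSeparated s (levelCell S (gridLabel a h) k (gridLabel a h k x))
      (levelCell S (gridLabel a h) k (gridLabel a h k y)) := by
  have hd : 0 < dist x y := dist_pos.2 hxy
  obtain ⟨k, hk⟩ := pow_unbounded_of_one_lt ((s + 2) * (√d * h) / dist x y) one_lt_two
  refine ⟨k, wellSeparated_of_le_dist_gridLabel hh hx hy ?_⟩
  rw [div_lt_iff₀ hd] at hk
  rw [← mul_div_assoc, ← mul_div_assoc, div_le_iff₀ (by positivity)]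
  linarith

end Grid

theorem exists_gridLabel_zero_eq {d : ℕ} (S : Finset (EuclideanSpace ℝ (Fin d))) :
    ∃ a h : ℝ, 0 < h ∧ ∀ x ∈ S, gridLabel a h 0 x = 0 := by
  obtain ⟨R, hR, hS⟩ := S.finite_toSet.isBounded.exists_pos_norm_lt
  refine ⟨R, 2 * R, by positivity, fun x hx => funext fun i => ?_⟩
  have h₁ : |x i| < R := (PiLp.norm_apply_le x i).trans_lt (hS x hx)
  obtain ⟨h₂, h₃⟩ := abs_lt.1 h₁
  simp only [gridLabel, Pi.zero_apply, pow_zero, one_mul]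
  rw [Int.floor_eq_zero_iff]
  exact ⟨div_nonneg (by linarith) (by positivity), (div_lt_one (by positivity)).2 (by linarith)⟩

/-- For every pair of distinct points `p` and `q`, the level preceding `sepLevel` contains a cell
that splits and contains `p` or `q`; the labels of `p` and `q` are close to those of any
point of that cell. -/
theorem exists_split_near_sepLevel {d : ℕ} {s a h : ℝ} (hs : 0 < s) (hh : 0 < h)
    {S : Finset (EuclideanSpace ℝ (Fin d))} (h₀ : ∀ x ∈ S, gridLabel a h 0 x = 0)
    {κ : EuclideanSpace ℝ (Fin d) → ℕ}
    (hκ : ∀ k, ∀ p ∈ S, levelCell S (gridLabel a h) k (gridLabel a h k p) ≠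
        levelCell S (gridLabel a h) (k + 1) (gridLabel a h (k + 1) p) →
      ∃ r ∈ S, gridLabel a h k r = gridLabel a h k p ∧ κ r = k + 1)
    {M : ℕ} (hM : 2 + 2 * ((s + 2) * √d) ≤ M)
    {p q : EuclideanSpace ℝ (Fin d)} (hp : p ∈ S) (hq : q ∈ S) (hpq : p ≠ q) :
    ∃ r ∈ S, κ r = sepLevel s S (gridLabel a h) p q ∧
      ∀ i, |gridLabel a h (κ r) p i - gridLabel a h (κ r) r i| ≤ M ∧
        |gridLabel a h (κ r) q i - gridLabel a h (κ r) r i| ≤ M := by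
  have hw := wellSeparated_sepLevel (exists_wellSeparated_gridLabel (a := a) (s := s) hh hp hq hpq)
  obtain hk | ⟨k, hk⟩ : sepLevel s S (gridLabel a h) p q = 0 ∨
      ∃ k, sepLevel s S (gridLabel a h) p q = k + 1 := by
    cases sepLevel s S (gridLabel a h) p q <;> simp
  · rw [hk, h₀ p hp, h₀ q hq] at hw
    exact absurd hw (not_wellSeparated_self hs (S.finite_toSet.subset fun _ hx => hx.1)
      ⟨p, ⟨hp, h₀ p hp⟩, q, ⟨hq, h₀ q hq⟩, hpq⟩)
  have hnw : ¬ WellSeparated s (levelCell S (gridLabel a h) k (gridLabel a h k p))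
      (levelCell S (gridLabel a h) k (gridLabel a h k q)) :=
    fun hcon => Nat.notMem_of_lt_sInf (m := k) (by rw [← sepLevel, hk]; omega) hcon
  have hdist : dist p q < (s + 2) * (√d * (h / 2 ^ k)) := by
    by_contra! hcon
    exact hnw (wellSeparated_of_le_dist_gridLabel hh hp hq hcon)
  have hside : h / 2 ^ k = 2 * (h / 2 ^ (k + 1)) := by
    rw [pow_succ]
    field_simp
  have hpos : 0 < h / 2 ^ (k + 1) := by positivity
  have hcoord : ∀ i, |p i - q i| ≤ 2 * ((s + 2) * √d) * (h / 2 ^ (k + 1)) := by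
    intro i
    have h₁ : |p i - q i| ≤ dist p q := by
      rw [dist_eq_norm]
      exact PiLp.norm_apply_le (p - q) i
    rw [hside] at hdist
    linarith
  rw [hk] at hw ⊢
  have hnear : ∀ x y r : EuclideanSpace ℝ (Fin d),
      (∀ i, |x i - y i| ≤ 2 * ((s + 2) * √d) * (h / 2 ^ (k + 1))) →
      gridLabel a h k r = gridLabel a h k y →
      ∀ i, |gridLabel a h (k + 1) x i - gridLabel a h (k + 1) r i| ≤ M := by
    intro x y r hxy hr i
    refine abs_gridLabel_sub_le hh ?_
    have h₁ := abs_sub_le_of_gridLabel_eq hh hr.symm i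
    rw [hside] at h₁
    have h₂ := abs_sub_le (x i) (y i) (r i)
    have h₃ := mul_le_mul_of_nonneg_right hM hpos.le
    linarith [hxy i]
  have hself : ∀ x : EuclideanSpace ℝ (Fin d), ∀ i,
      |x i - x i| ≤ 2 * ((s + 2) * √d) * (h / 2 ^ (k + 1)) := by
    intro x i
    rw [sub_self, abs_zero]
    positivity
  by_cases hsplit : levelCell S (gridLabel a h) k (gridLabel a h k p) =
      levelCell S (gridLabel a h) (k + 1) (gridLabel a h (k + 1) p)
  · obtain ⟨r, hr, hrq, hrk⟩ := hκ k q hq fun hcon => hnw (by rwa [hsplit, hcon])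
    refine ⟨r, hr, hrk, fun i => ?_⟩
    rw [hrk]
    exact ⟨hnear p q r hcoord hrq i, hnear q q r (hself q) hrq i⟩
  · obtain ⟨r, hr, hrp, hrk⟩ := hκ k p hp hsplit
    refine ⟨r, hr, hrk, fun i => ?_⟩
    rw [hrk]
    exact ⟨hnear p p r (hself p) hrp i,
      hnear q p r (fun i => abs_sub_comm (p i) (q i) ▸ hcoord i) hrp i⟩

/-- For every dimension `d ≥ 1` and every `s > 0` there is a constant `C` such
that every set `S` of `n` points in `ℝ^d` admits a WSPD with separation
constant `s` consisting of at most `C·n` pairs. -/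
theorem wspd_linear_size (d : ℕ) (hd : 1 ≤ d) (s : ℝ) (hs : 0 < s) :
    ∃ C : ℝ, ∀ S : Finset (EuclideanSpace ℝ (Fin d)),
      ∃ W : Finset (Sym2 (Set (EuclideanSpace ℝ (Fin d)))),
        IsWSPD s S W ∧ (W.card : ℝ) ≤ C * S.card := by
  classical
  obtain ⟨M, hM⟩ := exists_nat_ge (2 + 2 * ((s + 2) * √d))
  let box : Finset (Fin d → ℤ) := Fintype.piFinset fun _ => Finset.Icc (-(M : ℤ)) M
  refine ⟨(box ×ˢ box).card, fun S => ?_⟩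
  obtain ⟨a, h, hh, h₀⟩ := exists_gridLabel_zero_eq S
  obtain ⟨κ, hκ⟩ := exists_split_level (c := gridLabel a h) S fun _ _ _ => gridLabel_eq_of_succ
  refine ⟨_, isWSPD_image_sepPair (c := gridLabel a h) (fun _ _ _ => gridLabel_eq_of_succ)
    fun p hp q hq hpq => exists_wellSeparated_gridLabel hh hp hq hpq, ?_⟩
  let g : (((Fin d → ℤ) × (Fin d → ℤ)) × EuclideanSpace ℝ (Fin d)) →
      Sym2 (Set (EuclideanSpace ℝ (Fin d))) := fun x =>
    s(levelCell S (gridLabel a h) (κ x.2) (gridLabel a h (κ x.2) x.2 + x.1.1),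
      levelCell S (gridLabel a h) (κ x.2) (gridLabel a h (κ x.2) x.2 + x.1.2))
  have hsub : (S.offDiag.image fun x => sepPair s S (gridLabel a h) x.1 x.2) ⊆
      ((box ×ˢ box) ×ˢ S).image g := by
    intro e he
    obtain ⟨⟨p, q⟩, hpq, rfl⟩ := Finset.mem_image.1 he
    obtain ⟨hp, hq, hne⟩ := Finset.mem_offDiag.1 hpq
    obtain ⟨r, hr, hrk, hrM⟩ := exists_split_near_sepLevel hs hh h₀ hκ hM hp hq hne
    refine Finset.mem_image.2 ⟨((gridLabel a h (κ r) p - gridLabel a h (κ r) r,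
      gridLabel a h (κ r) q - gridLabel a h (κ r) r), r), ?_, ?_⟩
    · simp only [box, Finset.mem_product, Fintype.mem_piFinset, Finset.mem_Icc, Pi.sub_apply]
      exact ⟨⟨fun i => abs_le.1 (hrM i).1, fun i => abs_le.1 (hrM i).2⟩, hr⟩
    · simp only [g, add_sub_cancel, sepPair, hrk]
  have hcard := (Finset.card_le_card hsub).trans Finset.card_image_le
  rw [Finset.card_product] at hcard
  exact_mod_cast hcard
end
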